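/- Let p be a prime with p > 3 and r an integer with r ≥ 2. Then Σ_{k=(p^r+3)/2}^{p^r−1} G(p^r, k) ≡ (−1)^{(p^r−1)/2} · 15·p^{r+1}·q_p(2) (mod p^{r+2}), where G(n,k) = ((−1)^{n+k} / 4^{5n−4−k}) · n · C(2n−1, n−1) · C(2(2n−1+k), 2n−1+k) · C(2n−1+k, 2k) · C(2n−1−k, n−1) / C(2k,k). -/

import Mathlib

open Finset

/-- `a ≡ b (mod p^m)` for rationals: the `p`-adic valuation of `a - b` is at least `m`. -/
def pcong (p m : ℕ) (a b : ℚ) : Prop :=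
  a = b ∨ (m : ℤ) ≤ padicValRat p (a - b)

/-- \`G(n,k) = ((−1)^{n+k}/4^{5n−4−k}) · n · C(2n−1,n−1) · C(2(2n−1+k),2n−1+k) · C(2n−1+k,2k) · C(2n−1−k,n−1) / C(2k,k)\`. -/
def G (n k : ℕ) : ℚ :=
  (-1) ^ (n + k) / 4 ^ (5 * n - 4 - k) * (n : ℚ) * (((2 * n - 1).choose (n - 1) : ℕ) : ℚ) *
    (((2 * (2 * n - 1 + k)).choose (2 * n - 1 + k) : ℕ) : ℚ) *
    (((2 * n - 1 + k).choose (2 * k) : ℕ) : ℚ) *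
    (((2 * n - 1 - k).choose (n - 1) : ℕ) : ℚ) / (((2 * k).choose k : ℕ) : ℚ)

/-- The product of the first `m` odd numbers. -/
def oddProd (m : ℕ) : ℚ := ∏ i ∈ range m, (2 * (i : ℚ) + 1)

/-- The product of `1 + a / (2 i + 1)` over `i < m`: the ratio between a shifted product of `m`
odd numbers and `oddProd m`. -/
def oddShift (a : ℚ) (m : ℕ) : ℚ := ∏ i ∈ range m, (1 + a / (2 * (i : ℚ) + 1))

lemma oddProd_ne_zero (m : ℕ) : oddProd m ≠ 0 :=
  prod_ne_zero_iff.2 fun i _ => by positivity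

lemma oddProd_succ (m : ℕ) : oddProd (m + 1) = oddProd m * (2 * (m : ℚ) + 1) :=
  prod_range_succ _ _

lemma oddShift_mul_oddProd (a : ℚ) (m : ℕ) :
    oddShift a m * oddProd m = ∏ i ∈ range m, (2 * (i : ℚ) + 1 + a) := by
  rw [oddShift, oddProd, ← prod_mul_distrib]
  refine prod_congr rfl fun i _ => ?_
  have : (2 * (i : ℚ) + 1) ≠ 0 := by positivity
  field_simp

lemma oddProd_add (l m : ℕ) :
    oddProd (l + m) = oddProd l * (oddShift (2 * l) m * oddProd m) := by
  rw [oddShift_mul_oddProd, oddProd, prod_range_add]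
  congr 1
  refine prod_congr rfl fun i _ => ?_
  push_cast; ring

lemma oddProd_add_eq_neg_shift (k j : ℕ) :
    oddProd (k + j) = oddProd k * ((-1) ^ j * (oddShift (-(2 * ((k : ℚ) + j))) j * oddProd j)) := by
  rw [oddShift_mul_oddProd, oddProd, prod_range_add]
  congr 1
  rw [← prod_range_reflect, show ((-1 : ℚ)) ^ j = ∏ _i ∈ range j, (-1 : ℚ) by simp,
    ← prod_mul_distrib]
  refine prod_congr rfl fun i hi => ?_
  have hi := mem_range.1 hi
  rw [Nat.sub_sub, Nat.cast_add, Nat.cast_sub (by omega)]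
  push_cast; ring

lemma factorial_two_mul (m : ℕ) :
    (((2 * m).factorial : ℕ) : ℚ) = 2 ^ m * (m.factorial : ℚ) * oddProd m := by
  induction m with
  | zero => simp [oddProd]
  | succ m ih =>
    rw [oddProd_succ, show 2 * (m + 1) = 2 * m + 1 + 1 by ring, Nat.factorial_succ,
      Nat.factorial_succ, Nat.factorial_succ]
    push_cast
    rw [ih]; ring

lemma centralBinom_eq_oddProd (m : ℕ) :
    (((2 * m).choose m : ℕ) : ℚ) = 2 ^ m * oddProd m / (m.factorial : ℚ) := by
  have h : (m.factorial : ℚ) ≠ 0 := by exact_mod_cast m.factorial_ne_zero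
  rw [Nat.cast_choose ℚ (by omega : m ≤ 2 * m), factorial_two_mul, show 2 * m - m = m by omega]
  field_simp

lemma G_eq (k j : ℕ) :
    G (k + j + 2) (k + 1) =
      128 / 4 ^ (4 * (k + j + 2)) * ((k + j + 2 : ℕ) : ℚ) ^ 2 *
        ((2 * (k + j + 2) - 1).choose (k + j + 2 - 1) : ℕ) *
        ((2 * (k + j + 2)).choose (k + j + 2) : ℕ) *
        oddShift (2 * (k + j + 2 : ℕ)) (k + j + 2) * oddShift (4 * (k + j + 2 : ℕ)) k *
        oddShift (-(2 * (k + j + 2 : ℕ))) (j + 1) *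
        (((2 * (j + 1)).choose (j + 1) : ℕ) / 4 ^ (j + 1)) / (2 * k + 1) := by
  have hfac : ∀ m : ℕ, (m.factorial : ℚ) ≠ 0 := fun m => by exact_mod_cast m.factorial_ne_zero
  unfold G
  rw [show 2 * (k + j + 2) - 1 + (k + 1) = 3 * k + 2 * j + 4 by omega,
    show 2 * (k + j + 2) - 1 - (k + 1) = k + 2 * j + 2 by omega]
  generalize ((2 * (k + j + 2) - 1).choose (k + j + 2 - 1)) = c
  rw [centralBinom_eq_oddProd, centralBinom_eq_oddProd, centralBinom_eq_oddProd,
    centralBinom_eq_oddProd,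
    Nat.cast_choose ℚ (by omega : 2 * (k + 1) ≤ 3 * k + 2 * j + 4),
    Nat.cast_choose ℚ (by omega : k + j + 2 - 1 ≤ k + 2 * j + 2), factorial_two_mul,
    show 3 * k + 2 * j + 4 - 2 * (k + 1) = k + 2 * j + 2 by omega,
    show k + 2 * j + 2 - (k + j + 2 - 1) = j + 1 by omega,
    show k + j + 2 - 1 = k + j + 1 by omega,
    Nat.factorial_succ (k + j + 1)]
  have hO : oddProd (3 * k + 2 * j + 4) = oddProd (k + j + 2) *
      (oddShift (2 * (k + j + 2 : ℕ)) (k + j + 2) * oddProd (k + j + 2)) *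
      (oddShift (4 * (k + j + 2 : ℕ)) k * oddProd k) := by
    rw [show 3 * k + 2 * j + 4 = (k + j + 2) + (k + j + 2) + k by ring, oddProd_add, oddProd_add,
      show (2 : ℚ) * ((k + j + 2 + (k + j + 2) : ℕ) : ℚ) = 4 * (k + j + 2 : ℕ) by push_cast; ring]
  have hn : oddProd (k + j + 2) = oddProd (k + 1) *
      ((-1) ^ (j + 1) * (oddShift (-(2 * (k + j + 2 : ℕ))) (j + 1) * oddProd (j + 1))) := by
    rw [show k + j + 2 = (k + 1) + (j + 1) by ring, oddProd_add_eq_neg_shift]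
    push_cast; rfl
  have hsign : (-1 : ℚ) ^ (k + j + 2 + (k + 1)) = (-1) ^ (j + 1) := by
    rw [show k + j + 2 + (k + 1) = 2 * (k + 1) + (j + 1) by ring, pow_add, pow_mul]; simp
  have hpow : (2 : ℚ) ^ (3 * k + 2 * j + 4) * 4 ^ (4 * (k + j + 2)) * 4 ^ (j + 1) =
      128 * 2 ^ (k + j + 2) * 2 ^ (j + 1) * 4 ^ (5 * (k + j + 2) - 4 - (k + 1)) *
        (2 ^ (k + 1)) ^ 2 := by
    rw [show (128 : ℚ) = 2 ^ 7 by norm_num, show (4 : ℚ) = 2 ^ 2 by norm_num]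
    simp only [← pow_mul, ← pow_add]
    congr 1; omega
  have hs : ((-1 : ℚ) ^ (j + 1)) ^ 2 = 1 := by rw [← pow_mul, mul_comm, pow_mul]; simp
  nth_rewrite 1 [hn] at hO
  rw [hO, hsign]
  have h1 := oddProd_ne_zero k
  have h2 := hfac (k + 1)
  have h3 := hfac (3 * k + 2 * j + 4)
  have h4 := hfac (k + 2 * j + 2)
  have h5 := hfac (k + j + 1)
  have h6 := hfac (j + 1)
  have h7 : ((k + j + 2 : ℕ) : ℚ) ≠ 0 := by positivity
  have h8 : (2 * (k : ℚ) + 1) ≠ 0 := by positivity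
  rw [Nat.cast_mul, show k + j + 1 + 1 = k + j + 2 by ring]
  have hk := oddProd_succ k
  have h9 := oddProd_ne_zero (k + 1)
  generalize oddShift (2 * (k + j + 2 : ℕ)) (k + j + 2) = A at *
  generalize oddShift (4 * (k + j + 2 : ℕ)) k = B at *
  generalize oddShift (-(2 * (k + j + 2 : ℕ))) (j + 1) = D at *
  generalize ((k + j + 2 : ℕ) : ℚ) = n at *
  rw [hk] at h9 ⊢
  have hp1 : (4 : ℚ) ^ (4 * (k + j + 2)) ≠ 0 := by positivity
  have hp2 : (4 : ℚ) ^ (j + 1) ≠ 0 := by positivity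
  have hp3 : (2 : ℚ) ^ (k + 1) ≠ 0 := by positivity
  have hp4 : (4 : ℚ) ^ (5 * (k + j + 2) - 4 - (k + 1)) ≠ 0 := by positivity
  clear hO hn hsign hk hfac
  generalize (2 : ℚ) ^ (3 * k + 2 * j + 4) = t at *
  generalize (4 : ℚ) ^ (5 * (k + j + 2) - 4 - (k + 1)) = t2 at *
  generalize (4 : ℚ) ^ (4 * (k + j + 2)) = t3 at *
  generalize (4 : ℚ) ^ (j + 1) = t4 at *
  generalize (2 : ℚ) ^ (k + 1) = t5 at *
  generalize (2 : ℚ) ^ (k + j + 2) = t6 at *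
  generalize (2 : ℚ) ^ (j + 1) = t7 at *
  generalize (-1 : ℚ) ^ (j + 1) = s at *
  have ht : t = 128 * t6 * t7 * t2 * t5 ^ 2 / (t3 * t4) := by
    field_simp; linear_combination hpow
  rw [ht]
  field_simp
  linear_combination (c * t6 * t7 * D * oddProd (j + 1) * A * oddProd (k + j + 2) * B) * hs

section ModP
variable {p : ℕ} [hp : Fact p.Prime]

/-- `ReducesTo p x z`: the rational `x` is `p`-integral with residue class `z`. -/
def ReducesTo (p : ℕ) [Fact p.Prime] (x : ℚ) (z : ZMod p) : Prop :=
  ∃ a b : ℤ, (b : ZMod p) ≠ 0 ∧ x = a / b ∧ z = a / b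

namespace ReducesTo
variable {x y : ℚ} {z w : ZMod p}

lemma intCast (a : ℤ) : ReducesTo p a a := ⟨a, 1, by simp, by simp, by simp⟩

lemma natCast (a : ℕ) : ReducesTo p a a := by simpa using intCast (p := p) a

lemma one : ReducesTo p 1 1 := by simpa using natCast (p := p) 1

lemma zero : ReducesTo p 0 0 := by simpa using natCast (p := p) 0

lemma intCast_ne_zero {b : ℤ} (h : (b : ZMod p) ≠ 0) : (b : ℚ) ≠ 0 := by
  rintro h'
  rw [Int.cast_eq_zero] at h'
  simp [h'] at h

lemma mul (h : ReducesTo p x z) (h' : ReducesTo p y w) : ReducesTo p (x * y) (z * w) := by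
  obtain ⟨a, b, hb, rfl, rfl⟩ := h
  obtain ⟨c, d, hd, rfl, rfl⟩ := h'
  refine ⟨a * c, b * d, by simp [hb, hd], ?_, ?_⟩ <;> push_cast <;> rw [div_mul_div_comm]

lemma add (h : ReducesTo p x z) (h' : ReducesTo p y w) : ReducesTo p (x + y) (z + w) := by
  obtain ⟨a, b, hb, rfl, rfl⟩ := h
  obtain ⟨c, d, hd, rfl, rfl⟩ := h'
  refine ⟨a * d + b * c, b * d, by simp [hb, hd], ?_, ?_⟩ <;> push_cast
  · rw [div_add_div _ _ (intCast_ne_zero hb) (intCast_ne_zero hd)]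
  · rw [div_add_div _ _ hb hd]

lemma neg (h : ReducesTo p x z) : ReducesTo p (-x) (-z) := by
  simpa using (intCast (p := p) (-1)).mul h

lemma sub (h : ReducesTo p x z) (h' : ReducesTo p y w) : ReducesTo p (x - y) (z - w) := by
  simpa [sub_eq_add_neg] using h.add h'.neg

lemma inv (h : ReducesTo p x z) (hz : z ≠ 0) : ReducesTo p x⁻¹ z⁻¹ := by
  obtain ⟨a, b, hb, rfl, rfl⟩ := h
  exact ⟨b, a, fun ha => by simp [ha] at hz, by rw [inv_div], by rw [inv_div]⟩

lemma div (h : ReducesTo p x z) (h' : ReducesTo p y w) (hw : w ≠ 0) :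
    ReducesTo p (x / y) (z / w) := by
  simpa [div_eq_mul_inv] using h.mul (h'.inv hw)

lemma pow (h : ReducesTo p x z) (n : ℕ) : ReducesTo p (x ^ n) (z ^ n) := by
  induction n with
  | zero => simpa using one
  | succ n ih => simpa [pow_succ] using ih.mul h

lemma sum {ι : Type*} {s : Finset ι} {f : ι → ℚ} {g : ι → ZMod p}
    (h : ∀ i ∈ s, ReducesTo p (f i) (g i)) : ReducesTo p (∑ i ∈ s, f i) (∑ i ∈ s, g i) := by
  classical
  induction s using Finset.induction_on with
  | empty => simpa using zero
  | insert a s ha ih =>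
    rw [sum_insert ha, sum_insert ha]
    exact (h a (mem_insert_self _ _)).add (ih fun i hi => h i (mem_insert_of_mem hi))

lemma prod {ι : Type*} {s : Finset ι} {f : ι → ℚ} {g : ι → ZMod p}
    (h : ∀ i ∈ s, ReducesTo p (f i) (g i)) : ReducesTo p (∏ i ∈ s, f i) (∏ i ∈ s, g i) := by
  classical
  induction s using Finset.induction_on with
  | empty => simpa using one
  | insert a s ha ih =>
    rw [prod_insert ha, prod_insert ha]
    exact (h a (mem_insert_self _ _)).mul (ih fun i hi => h i (mem_insert_of_mem hi))

lemma padicValRat_pow_mul (h : ReducesTo p x 0) (hx : x ≠ 0) (m : ℕ) :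
    ((m + 1 : ℕ) : ℤ) ≤ padicValRat p ((p : ℚ) ^ m * x) := by
  obtain ⟨a, b, hb, rfl, h0⟩ := h
  have hb' := intCast_ne_zero hb
  have ha : (a : ℚ) ≠ 0 := fun h => by simp [h] at hx
  have hp0 : (p : ℚ) ≠ 0 := by exact_mod_cast hp.out.ne_zero
  rw [padicValRat.mul (pow_ne_zero _ hp0) hx, padicValRat.pow, padicValRat.div ha hb',
    padicValRat.self hp.out.one_lt, padicValRat.of_int, padicValRat.of_int,
    padicValInt.eq_zero_of_not_dvd fun h => hb ((ZMod.intCast_zmod_eq_zero_iff_dvd b p).2 h)]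
  have h1 : (p : ℤ) ∣ a := by
    rw [← ZMod.intCast_zmod_eq_zero_iff_dvd]
    simpa [hb, eq_comm] using h0
  have h2 : 1 ≤ padicValInt p a := by
    have := (padicValInt_dvd_iff (p := p) 1 a).1 (by simpa using h1)
    tauto
  push_cast
  linarith [(by exact_mod_cast h2 : (1 : ℤ) ≤ padicValInt p a)]

lemma pow_div_pow_mul {s t u : ℕ} (hst : s ≤ t) (hu : ¬ p ∣ u) :
    ReducesTo p ((p : ℚ) ^ t / ((p ^ s * u : ℕ) : ℚ)) ((p : ZMod p) ^ (t - s) / u) := by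
  have hp0 : (p : ℚ) ≠ 0 := by exact_mod_cast hp.out.ne_zero
  have hu' : (u : ZMod p) ≠ 0 := by rwa [Ne, ZMod.natCast_eq_zero_iff]
  have h := ((natCast (p := p) p).pow (t - s)).div (natCast u) hu'
  convert h using 1
  have hu0 : (u : ℚ) ≠ 0 := by
    rintro h0
    rw [Nat.cast_eq_zero] at h0
    simp [h0] at hu
  push_cast
  rw [← Nat.sub_add_cancel hst, pow_add]
  simp only [Nat.add_sub_cancel]
  field_simp

lemma pow_div_of_not_dvd {r m : ℕ} (hm : m ≠ 0) (hndvd : ¬ p ^ r ∣ m) :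
    ReducesTo p ((p : ℚ) ^ r / m) 0 := by
  obtain ⟨s, u, hu, rfl⟩ := Nat.exists_eq_pow_mul_and_not_dvd hm p hp.out.ne_one
  have hs : s < r := by
    by_contra h
    exact hndvd (Dvd.dvd.mul_right (pow_dvd_pow p (not_lt.1 h)) u)
  simpa [Nat.sub_ne_zero_of_lt hs] using pow_div_pow_mul (p := p) hs.le hu

end ReducesTo

lemma choose_pred_prime (k : ℕ) (hk : k < p) : ((p - 1).choose k : ZMod p) = (-1) ^ k := by
  induction k with
  | zero => simp
  | succ k ih =>
    have h : p.choose (k + 1) = (p - 1).choose k + (p - 1).choose (k + 1) := by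
      conv_lhs => rw [← Nat.sub_add_cancel hp.out.one_le]
      exact Nat.choose_succ_succ _ _
    have h0 : (p.choose (k + 1) : ZMod p) = 0 := by
      rw [ZMod.natCast_eq_zero_iff]
      exact hp.out.dvd_choose_self (by omega) hk
    have h2 := ih (by omega)
    rw [h] at h0
    push_cast at h0
    rw [pow_succ]
    linear_combination h0 - h2

lemma choose_mul_add (a b c d : ℕ) (hc : c < p) (hd : d < p) :
    ((p * a + c).choose (p * b + d) : ZMod p) = c.choose d * a.choose b := by
  have h := Choose.choose_modEq_choose_mod_mul_choose_div_nat (p := p)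
    (n := p * a + c) (k := p * b + d)
  have hp0 := hp.out.pos
  rw [Nat.mul_add_mod, Nat.mul_add_mod, Nat.mod_eq_of_lt hc, Nat.mod_eq_of_lt hd,
    Nat.mul_add_div hp0, Nat.mul_add_div hp0, Nat.div_eq_of_lt hc, Nat.div_eq_of_lt hd] at h
  have := (ZMod.natCast_eq_natCast_iff _ _ p).2 h
  simpa using this

lemma choose_two_mul_prime_pow (r : ℕ) : ((2 * p ^ r).choose (p ^ r) : ZMod p) = 2 := by
  induction r with
  | zero => simp
  | succ r ih =>
    have h := choose_mul_add (p := p) (2 * p ^ r) (p ^ r) 0 0 hp.out.pos hp.out.pos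
    rw [ih] at h
    rw [show 2 * p ^ (r + 1) = p * (2 * p ^ r) + 0 by ring, show p ^ (r + 1) = p * p ^ r + 0 by ring]
    simpa using h

/-- The central binomial coefficient divided by the corresponding power of four, modulo `p`. -/
def scaledCentral (p j : ℕ) [Fact p.Prime] : ZMod p := ((2 * j).choose j : ZMod p) / 4 ^ j

variable {h : ℕ}

lemma two_ne_zero_of_odd (hh : p = 2 * h + 1) : (2 : ZMod p) ≠ 0 := by
  intro h2
  have : (p : ℕ) ∣ 2 := by
    rw [← ZMod.natCast_eq_zero_iff]; exact_mod_cast h2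
  have := (Nat.prime_dvd_prime_iff_eq hp.out Nat.prime_two).1 this
  omega

lemma four_ne_zero_of_odd (hh : p = 2 * h + 1) : (4 : ZMod p) ≠ 0 := by
  rw [show (4 : ZMod p) = 2 * 2 by norm_num]
  exact mul_ne_zero (two_ne_zero_of_odd hh) (two_ne_zero_of_odd hh)

lemma scaledCentral_mul_add (hh : p = 2 * h + 1) (j : ℕ) :
    scaledCentral p (p * j + h) = (-1) ^ h * scaledCentral p j := by
  have h4 : (4 : ZMod p) ^ h = 1 := by
    rw [show (4 : ZMod p) = 2 ^ 2 by norm_num, ← pow_mul, show 2 * h = p - 1 by omega]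
    exact ZMod.pow_card_sub_one_eq_one (two_ne_zero_of_odd hh)
  rw [scaledCentral, scaledCentral, show 2 * (p * j + h) = p * (2 * j) + (p - 1) by
    rw [mul_add, show 2 * h = p - 1 by omega]; ring,
    choose_mul_add _ _ _ _ (by omega) (by omega), choose_pred_prime h (by omega), pow_add, pow_mul,
    ZMod.pow_card, h4]
  ring

lemma scaledCentral_of_pow_mul (hh : p = 2 * h + 1) (v : ℕ) :
    ∀ s j : ℕ, 2 * j + 1 = p ^ s * (2 * v + 1) →
      scaledCentral p j = (-1) ^ (h * s) * scaledCentral p v := by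
  intro s
  induction s with
  | zero => 
    intro j hj
    rw [pow_zero, one_mul] at hj
    rw [show j = v by omega]; simp
  | succ s ih =>
    intro j hj
    have hodd : Odd (p ^ s * (2 * v + 1)) :=
      (Odd.pow ⟨h, hh⟩).mul ⟨v, rfl⟩
    obtain ⟨j', hj'⟩ := hodd
    have hjj : j = p * j' + h := by
      have : 2 * j + 1 = p * (2 * j' + 1) := by rw [← hj', hj]; ring
      have h2 : p * (2 * j' + 1) = 2 * (p * j') + p := by ring
      omega
    rw [hjj, scaledCentral_mul_add hh, ih j' hj'.symm]
    ring

lemma natCast_ne_zero_of_lt {i : ℕ} (h0 : i ≠ 0) (hi : i < p) : (i : ZMod p) ≠ 0 := by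
  rw [Ne, ZMod.natCast_eq_zero_iff]
  exact Nat.not_dvd_of_pos_of_lt (Nat.pos_of_ne_zero h0) hi

lemma scaledCentral_eq (hh : p = 2 * h + 1) (v : ℕ) (hv : v ≤ h) :
    scaledCentral p v = (-1) ^ v * (h.choose v : ZMod p) := by
  have h40 := four_ne_zero_of_odd hh
  induction v with
  | zero => simp [scaledCentral]
  | succ v ih =>
    have ih := ih (by omega)
    have hc := congrArg (Nat.cast (R := ZMod p)) (Nat.succ_mul_centralBinom_succ v)
    have hb := congrArg (Nat.cast (R := ZMod p)) (Nat.choose_succ_right_eq h v)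
    rw [Nat.centralBinom, Nat.centralBinom] at hc
    have hv0 : ((v + 1 : ℕ) : ZMod p) ≠ 0 := natCast_ne_zero_of_lt (by omega) (by omega)
    have hp0 : (2 : ZMod p) * h + 1 = 0 := by
      have h' : ((2 * h + 1 : ℕ) : ZMod p) = 0 := by
        rw [ZMod.natCast_eq_zero_iff, ← hh]
      exact_mod_cast h'
    rw [scaledCentral, div_eq_iff (pow_ne_zero _ h40)] at ih ⊢
    apply mul_left_cancel₀ hv0
    push_cast [Nat.cast_sub (show v ≤ h by omega)] at hc hb ⊢
    rw [hc, ih]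
    have hb' : ((v : ZMod p) + 1) * (h.choose (v + 1) : ZMod p) = h.choose v * (h - v) := by
      rw [← hb]; ring
    linear_combination (4 ^ (v + 1) * (-1) ^ v : ZMod p) * hb' +
      (2 * (-1) ^ v * 4 ^ v * (h.choose v : ZMod p)) * hp0

lemma sum_alternating_choose_div (m : ℕ) (hm : m < p) :
    ∑ w ∈ range m, (-1) ^ w * (m.choose (w + 1) : ZMod p) / ((w : ZMod p) + 1) =
      ∑ w ∈ range m, ((w : ZMod p) + 1)⁻¹ := by
  induction m with
  | zero => simp
  | succ m ih =>
    have ne : ∀ w, w < m + 1 → (w : ZMod p) + 1 ≠ 0 := fun w hw => by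
      exact_mod_cast natCast_ne_zero_of_lt (p := p) (i := w + 1) (by omega) (by omega)
    rw [sum_range_succ (fun w : ℕ => ((w : ZMod p) + 1)⁻¹) m, ← ih (by omega)]
    have hterm : ∀ w ∈ range (m + 1),
        (-1) ^ w * ((m + 1).choose (w + 1) : ZMod p) / ((w : ZMod p) + 1) =
        (-1) ^ w * (m.choose (w + 1) : ZMod p) / ((w : ZMod p) + 1) +
          ((m : ZMod p) + 1)⁻¹ * ((-1) ^ w * ((m + 1).choose (w + 1) : ZMod p)) := by
      intro w hw
      have h1 := ne w (mem_range.1 hw)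
      have h2 := ne m (by omega)
      have h3 := congrArg (Nat.cast (R := ZMod p)) (Nat.add_one_mul_choose_eq m w)
      have h4 := congrArg (Nat.cast (R := ZMod p)) (Nat.choose_succ_succ m w)
      push_cast at h3 h4
      field_simp
      simp only [Nat.succ_eq_add_one] at h4
      linear_combination h3 + ((m : ZMod p) + 1) * h4
    rw [sum_congr rfl hterm, sum_add_distrib, ← mul_sum]
    have halt : ∑ w ∈ range (m + 1), (-1) ^ w * ((m + 1).choose (w + 1) : ZMod p) = 1 := by
      have := Int.alternating_sum_range_choose_of_ne (n := m + 1) (by omega)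
      rw [sum_range_succ'] at this
      have := congrArg (Int.cast (R := ZMod p)) this
      push_cast at this
      simp only [pow_succ, mul_neg, mul_one, neg_mul, sum_neg_distrib] at this
      simp at this
      linear_combination -this
    rw [halt, sum_range_succ]
    simp

lemma sum_inv_eq_zero (hh : p = 2 * h + 1) :
    ∑ w ∈ range (2 * h), ((w : ZMod p) + 1)⁻¹ = 0 := by
  have h1 : ∑ w ∈ range (2 * h), ((w : ZMod p) + 1)⁻¹ =
      -∑ w ∈ range (2 * h), ((w : ZMod p) + 1)⁻¹ := by
    conv_lhs => rw [← sum_range_reflect]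
    rw [← sum_neg_distrib]
    refine sum_congr rfl fun w hw => ?_
    have hw := mem_range.1 hw
    rw [← inv_neg]
    congr 1
    have h' : ((2 * h - 1 - w + 1 + (w + 1) : ℕ) : ZMod p) = 0 := by
      rw [show 2 * h - 1 - w + 1 + (w + 1) = p by omega]
      exact ZMod.natCast_self p
    push_cast at h'
    linear_combination h'
  have h2 : (2 : ZMod p) * ∑ w ∈ range (2 * h), ((w : ZMod p) + 1)⁻¹ = 0 := by
    linear_combination h1
  exact (mul_eq_zero.1 h2).resolve_left (two_ne_zero_of_odd hh)

lemma sum_alternating_inv (hh : p = 2 * h + 1) (m : ℕ) :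
    ∑ w ∈ range (2 * m), (-1) ^ w * ((w : ZMod p) + 1)⁻¹ =
      ∑ w ∈ range (2 * m), ((w : ZMod p) + 1)⁻¹ - ∑ w ∈ range m, ((w : ZMod p) + 1)⁻¹ := by
  induction m with
  | zero => simp
  | succ m ih =>
    have h2 := two_ne_zero_of_odd hh
    rw [show 2 * (m + 1) = 2 * m + 1 + 1 by ring]
    simp only [sum_range_succ _ (2 * m + 1), sum_range_succ _ (2 * m), sum_range_succ _ m, ih]
    have h3 : (((2 * m + 1 : ℕ) : ZMod p) + 1)⁻¹ = 2⁻¹ * ((m : ZMod p) + 1)⁻¹ := by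
      rw [← mul_inv]; push_cast; congr 1; ring
    have h4 : (2 : ZMod p) * 2⁻¹ = 1 := mul_inv_cancel₀ h2
    rw [h3, pow_succ, pow_mul]
    simp only [even_two, Even.neg_pow, one_pow]
    linear_combination (-((m : ZMod p) + 1)⁻¹) * h4

/-- The harmonic number of index `(p - 1) / 2` is minus twice the Fermat quotient of `2`. -/
lemma two_mul_fermatQuotient (hh : p = 2 * h + 1) (t : ℕ) (ht : 2 ^ (p - 1) = 1 + p * t) :
    (2 : ZMod p) * t = -∑ w ∈ range h, ((w : ZMod p) + 1)⁻¹ := by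
  have hp0 := hp.out.pos
  have hdvd : ∀ w ∈ range (2 * h), p ∣ p.choose (w + 1) := fun w hw =>
    hp.out.dvd_choose_self (by omega) (by have := mem_range.1 hw; omega)
  have hs : 2 * t = ∑ w ∈ range (2 * h), p.choose (w + 1) / p := by
    apply Nat.eq_of_mul_eq_mul_left hp0
    rw [mul_sum, sum_congr rfl fun w hw => Nat.mul_div_cancel' (hdvd w hw)]
    have h1 := Nat.sum_range_choose p
    rw [sum_range_succ, Nat.choose_self, sum_congr (congrArg range hh) fun _ _ => rfl,
      sum_range_succ', Nat.choose_zero_right] at h1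
    have h2 : 2 ^ p = 2 * 2 ^ (p - 1) := by
      rw [← pow_succ', Nat.sub_add_cancel hp.out.one_le]
    rw [h2, ht] at h1
    linarith
  have hq : ∀ w ∈ range (2 * h), ((p.choose (w + 1) / p : ℕ) : ZMod p) =
      (-1) ^ w * ((w : ZMod p) + 1)⁻¹ := by
    intro w hw
    have hlt := mem_range.1 hw
    have h1 : (w : ZMod p) + 1 ≠ 0 := by
      exact_mod_cast natCast_ne_zero_of_lt (p := p) (i := w + 1) (by omega) (by omega)
    have h2 : p.choose (w + 1) / p * (w + 1) = (p - 1).choose w := by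
      apply Nat.eq_of_mul_eq_mul_left hp0
      rw [← mul_assoc, Nat.mul_div_cancel' (hdvd w hw)]
      have := Nat.add_one_mul_choose_eq (p - 1) w
      rw [Nat.sub_add_cancel hp.out.one_le] at this
      exact this.symm
    rw [← div_eq_mul_inv, eq_div_iff h1, ← choose_pred_prime w (by omega), ← h2]
    push_cast; ring
  have hs' := congrArg (Nat.cast (R := ZMod p)) hs
  rw [Nat.cast_sum, sum_congr rfl hq, sum_alternating_inv hh, sum_inv_eq_zero hh] at hs'
  push_cast at hs'
  rw [hs']; ring

lemma sum_scaledCentral_div (hh : p = 2 * h + 1) (t : ℕ) (ht : 2 ^ (p - 1) = 1 + p * t) :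
    ∑ v ∈ range h, scaledCentral p v / (2 * (v : ZMod p) + 1) = -((-1) ^ h * t) := by
  have h2 := two_ne_zero_of_odd hh
  have hterm : ∀ w ∈ range h, scaledCentral p (h - 1 - w) / (2 * ((h - 1 - w : ℕ) : ZMod p) + 1) =
      ((-1) ^ h / 2) * ((-1) ^ w * (h.choose (w + 1) : ZMod p) / ((w : ZMod p) + 1)) := by
    intro w hw
    have hlt := mem_range.1 hw
    have h1 : (w : ZMod p) + 1 ≠ 0 := by
      exact_mod_cast natCast_ne_zero_of_lt (p := p) (i := w + 1) (by omega) (by omega)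
    have h3 : (2 * ((h - 1 - w : ℕ) : ZMod p) + 1) = -(2 * ((w : ZMod p) + 1)) := by
      have h' : ((2 * (h - 1 - w) + 1 + 2 * (w + 1) : ℕ) : ZMod p) = 0 := by
        rw [show 2 * (h - 1 - w) + 1 + 2 * (w + 1) = p by omega]
        exact ZMod.natCast_self p
      push_cast at h'
      linear_combination h'
    have h4 : (-1 : ZMod p) ^ h = (-1) ^ (h - 1 - w) * (-1) ^ (w + 1) := by
      rw [← pow_add]; congr 1; omega
    have h5 : (-1 : ZMod p) ^ w * (-1) ^ w = 1 := by
      rw [← pow_add, ← two_mul, pow_mul]; simp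
    rw [h3, scaledCentral_eq hh _ (by omega), ← Nat.choose_symm (show w + 1 ≤ h by omega),
      show h - (w + 1) = h - 1 - w by omega, h4, pow_succ]
    field_simp
    linear_combination (h.choose (h - 1 - w) : ZMod p) * h5
  rw [← sum_range_reflect, sum_congr rfl hterm, ← mul_sum,
    sum_alternating_choose_div h (by omega)]
  rw [show ∑ w ∈ range h, ((w : ZMod p) + 1)⁻¹ = -(2 * t) by
    rw [two_mul_fermatQuotient hh t ht, neg_neg]]
  field_simp
end ModP

lemma neg_one_pow_half_pow {p h : ℕ} (hh : p = 2 * h + 1) :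
    ∀ r M : ℕ, p ^ r = 2 * M + 1 → (-1 : ℚ) ^ M = (-1) ^ (h * r) := by
  intro r
  induction r with
  | zero => intro M hM; simp at hM; simp [hM]
  | succ r ih =>
    intro M hM
    obtain ⟨M', hM'⟩ : Odd (p ^ r) := Odd.pow ⟨h, hh⟩
    have h1 : M = p * M' + h := by
      have h2 : 2 * M + 1 = 2 * (p * M') + p := by rw [← hM, pow_succ, hM']; ring
      omega
    rw [h1, pow_add, pow_mul, Odd.neg_one_pow ⟨h, hh⟩, ih M' hM']
    ring

section PrimePower
variable {p : ℕ} [hp : Fact p.Prime]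

lemma reducesTo_oddShift {r M m : ℕ} (hM : p ^ r = 2 * M + 1) (hm : m ≤ p ^ r) (c : ℤ) :
    ReducesTo p (oddShift (c * (p ^ r : ℕ)) m) (if M < m then 1 + (c : ZMod p) else 1) := by
  have hprod : (∏ i ∈ range m, if i = M then 1 + (c : ZMod p) else 1) =
      if M < m then 1 + (c : ZMod p) else 1 := by
    rw [prod_ite_eq']; simp
  rw [← hprod]
  refine ReducesTo.prod fun i hi => ?_
  have hi := mem_range.1 hi
  split_ifs with h
  · have h1 : (c * (p ^ r : ℕ) / (2 * (i : ℚ) + 1) : ℚ) = c := by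
      have : (2 * (i : ℚ) + 1) ≠ 0 := by positivity
      rw [hM, h]; push_cast; rw [h] at this; field_simp
    rw [h1]
    exact ReducesTo.one.add (ReducesTo.intCast c)
  · have hndvd : ¬ p ^ r ∣ 2 * i + 1 := by
      rintro ⟨u, hu⟩
      rcases u with _ | _ | u
      · omega
      · omega
      · have : p ^ r * (u + 1 + 1) = p ^ r * u + 2 * p ^ r := by ring
        omega
    have := ReducesTo.one.add
      ((ReducesTo.intCast (p := p) c).mul (ReducesTo.pow_div_of_not_dvd (by omega) hndvd))
    rw [mul_zero, add_zero] at this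
    convert this using 1
    push_cast; ring

/-- The `p`-adically dominant factor of a summand, with its `p`-integral cofactor. -/
lemma G_reducesTo {h r M j : ℕ} (hh : p = 2 * h + 1) (hM : p ^ (r + 1) = 2 * M + 1)
    (hj : j + 1 < M) :
    ∃ U : ℚ, G (p ^ (r + 1)) (2 * M - j) =
        (p : ℚ) ^ (r + 2) * ((p : ℚ) ^ r / ((2 * (j + 1) + 1 : ℕ) : ℚ) * U) ∧
      ReducesTo p U (-(15 * scaledCentral p (j + 1))) := by
  have h40 := four_ne_zero_of_odd hh
  have h20 := two_ne_zero_of_odd hh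
  obtain ⟨k, hk⟩ : ∃ k, 2 * M = k + j + 1 := ⟨2 * M - j - 1, by omega⟩
  have hn : p ^ (r + 1) = k + j + 2 := by omega
  have hG := G_eq k j
  rw [← hn, show k + 1 = 2 * M - j by omega] at hG
  have hndvd : ¬ p ^ (r + 1) ∣ 2 * (j + 1) + 1 := Nat.not_dvd_of_pos_of_lt (by omega) (by omega)
  have hE : ReducesTo p (1 - 2 * ((p : ℚ) ^ (r + 1) / ((2 * (j + 1) + 1 : ℕ) : ℚ))) 1 := by
    simpa using ReducesTo.one.sub ((ReducesTo.natCast (p := p) 2).mul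
      (ReducesTo.pow_div_of_not_dvd (by omega) hndvd))
  have hC2 := choose_two_mul_prime_pow (p := p) (r + 1)
  have hC1 : ((2 * p ^ (r + 1) - 1).choose (p ^ (r + 1) - 1) : ZMod p) = 1 := by
    have h1 : (2 * p ^ (r + 1)).choose (p ^ (r + 1)) =
        2 * (2 * p ^ (r + 1) - 1).choose (p ^ (r + 1) - 1) := by
      have h2 := Nat.choose_succ_succ (2 * p ^ (r + 1) - 1) (p ^ (r + 1) - 1)
      rw [Nat.succ_eq_add_one, Nat.succ_eq_add_one, Nat.sub_add_cancel (by omega),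
        Nat.sub_add_cancel (by omega)] at h2
      rw [h2, Nat.choose_symm_of_eq_add (show 2 * p ^ (r + 1) - 1 =
        p ^ (r + 1) + (p ^ (r + 1) - 1) by omega)]
      ring
    rw [h1] at hC2
    push_cast at hC2
    apply mul_left_cancel₀ h20
    rw [hC2, mul_one]
  have hA := reducesTo_oddShift (p := p) (m := p ^ (r + 1)) hM le_rfl 2
  have hB := reducesTo_oddShift (p := p) (m := k) hM (by omega) 4
  have hD := reducesTo_oddShift (p := p) (m := j + 1) hM (by omega) (-2)
  rw [if_pos (by omega)] at hA hB
  rw [if_neg (by omega)] at hD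
  have h4 : ReducesTo p ((4 : ℚ) ^ (4 * p ^ (r + 1))) (4 ^ 4) := by
    have := (ReducesTo.natCast (p := p) 4).pow (4 * p ^ (r + 1))
    rw [mul_comm, pow_mul ((4 : ℕ) : ZMod p), ZMod.pow_card_pow] at this
    rw [mul_comm]
    exact_mod_cast this
  have hf : ReducesTo p (((2 * (j + 1)).choose (j + 1) : ℕ) / (4 : ℚ) ^ (j + 1))
      (scaledCentral p (j + 1)) :=
    (ReducesTo.natCast _).div (by exact_mod_cast (ReducesTo.natCast (p := p) 4).pow (j + 1))
      (pow_ne_zero _ h40)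
  have hc : ReducesTo p (128 / (4 : ℚ) ^ (4 * p ^ (r + 1))) (128 / 4 ^ 4) :=
    (by exact_mod_cast ReducesTo.natCast (p := p) 128 : ReducesTo p 128 128).div h4
      (pow_ne_zero _ h40)
  have hU := (((((((hc.mul (ReducesTo.natCast
    ((2 * p ^ (r + 1) - 1).choose (p ^ (r + 1) - 1)))).mul (ReducesTo.natCast
    ((2 * p ^ (r + 1)).choose (p ^ (r + 1))))).mul hA).mul hB).mul hD).mul hf).div hE
      one_ne_zero).neg
  refine ⟨_, ?_, by convert hU using 1; rw [hC1, hC2]; push_cast; field_simp; ring⟩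
  rw [hG]
  have hkq : (2 * (k : ℚ) + 1) = 2 * (p : ℚ) ^ (r + 1) - ((2 * (j + 1) + 1 : ℕ) : ℚ) := by
    have h1 : 2 * k + 1 + (2 * (j + 1) + 1) = 2 * p ^ (r + 1) := by omega
    have h2 : (2 * (k : ℚ) + 1) + ((2 * (j + 1) + 1 : ℕ) : ℚ) = 2 * (p : ℚ) ^ (r + 1) := by
      exact_mod_cast h1
    linarith
  have hk0 : (2 * (k : ℚ) + 1) ≠ 0 := by positivity
  have hm0 : ((2 * (j + 1) + 1 : ℕ) : ℚ) ≠ 0 := by positivity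
  have hden : (1 - 2 * ((p : ℚ) ^ (r + 1) / ((2 * (j + 1) + 1 : ℕ) : ℚ))) =
      -((2 * (k : ℚ) + 1) / ((2 * (j + 1) + 1 : ℕ) : ℚ)) := by
    rw [hkq]; field_simp; ring
  rw [hden]
  have h40q : (4 : ℚ) ^ (4 * p ^ (r + 1)) ≠ 0 := by positivity
  simp only [Int.cast_ofNat, Int.cast_neg, neg_mul]
  generalize ((2 * (j + 1) + 1 : ℕ) : ℚ) = m at *
  generalize (((2 * (j + 1)).choose (j + 1) : ℕ) / (4 : ℚ) ^ (j + 1)) = f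
  rw [Nat.cast_pow]
  field_simp
  ring

lemma sum_scaledCentral_filter {h r M : ℕ} (hh : p = 2 * h + 1) (hr : 1 ≤ r) (hp3 : 3 < p)
    (hM : p ^ (r + 1) = 2 * M + 1) :
    ∑ j ∈ (range (M - 1)).filter (fun j => p ^ r ∣ 2 * (j + 1) + 1),
        (((2 * (j + 1) + 1) / p ^ r : ℕ) : ZMod p)⁻¹ * -(15 * scaledCentral p (j + 1)) =
      ∑ v ∈ range h, -(15 * (-1) ^ (h * r)) * (scaledCentral p v / (2 * (v : ZMod p) + 1)) := by
  have hP : 3 < p ^ r := lt_of_lt_of_le hp3 (Nat.le_self_pow (by omega) p)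
  obtain ⟨Q, hQ⟩ : Odd (p ^ r) := Odd.pow ⟨h, hh⟩
  have hsplit : p ^ (r + 1) = p ^ r * (2 * h + 1) := by rw [pow_succ, ← hh]
  have hinv : ∀ v, 2 * ((p ^ r * (2 * v + 1) - 3) / 2 + 1) + 1 = p ^ r * (2 * v + 1) := by
    intro v
    obtain ⟨w, hw⟩ : Odd (p ^ r * (2 * v + 1)) := Odd.mul ⟨Q, hQ⟩ ⟨v, rfl⟩
    have : p ^ r ≤ p ^ r * (2 * v + 1) := Nat.le_mul_of_pos_right _ (by omega)
    omega
  symm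
  refine sum_bij (fun v _ => (p ^ r * (2 * v + 1) - 3) / 2) ?_ ?_ ?_ ?_
  · intro v hv
    have hv := mem_range.1 hv
    rw [mem_filter, mem_range]
    refine ⟨?_, by rw [hinv]; exact Dvd.intro _ rfl⟩
    have h1 := hinv v
    have h2 : p ^ r * (2 * v + 1) < p ^ r * (2 * h + 1) :=
      Nat.mul_lt_mul_of_pos_left (by omega) (by omega)
    omega
  · intro v _ w _ hvw
    have h1 := hinv v
    have h2 := hinv w
    rw [hvw, h2] at h1
    have := Nat.eq_of_mul_eq_mul_left (by omega) h1
    omega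
  · intro j hj
    rw [mem_filter, mem_range] at hj
    obtain ⟨hj, u, hu⟩ := hj
    have hodd : Odd (p ^ r * u) := ⟨j + 1, hu.symm⟩
    obtain ⟨v, rfl⟩ := (Nat.odd_mul.1 hodd).2
    refine ⟨v, ?_, ?_⟩
    · rw [mem_range]
      have h2 : p ^ r * (2 * v + 1) < p ^ r * (2 * h + 1) := by omega
      have := Nat.lt_of_mul_lt_mul_left h2
      omega
    · have := hinv v
      omega
  · intro v hv
    rw [hinv, Nat.mul_div_cancel_left _ (by omega), scaledCentral_of_pow_mul hh v r _ (hinv v)]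
    push_cast
    ring

end PrimePower

theorem stmt_19 (p : ℕ) (hp : p.Prime) (hp3 : 3 < p) (r : ℕ) (hr : 2 ≤ r) :
    pcong p (r + 2) (∑ k ∈ Icc ((p ^ r + 3) / 2) (p ^ r - 1), G (p ^ r) k)
      ((-1) ^ ((p ^ r - 1) / 2) * 15 * (p : ℚ) ^ (r + 1) *
        (((2 : ℚ) ^ (p - 1) - 1) / (p : ℚ))) := by
  have : Fact p.Prime := ⟨hp⟩
  obtain ⟨h, hh⟩ : Odd p := hp.odd_of_ne_two (by omega)
  obtain ⟨s, rfl⟩ : ∃ s, r = s + 1 := ⟨r - 1, by omega⟩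
  obtain ⟨M, hM⟩ : Odd (p ^ (s + 1)) := Odd.pow ⟨h, hh⟩
  have hp0 : (p : ℚ) ≠ 0 := by exact_mod_cast hp.ne_zero
  obtain ⟨t, ht⟩ : ∃ t, 2 ^ (p - 1) = 1 + p * t := by
    have h1 : p ∣ 2 ^ (p - 1) - 1 := by
      rw [← ZMod.natCast_eq_zero_iff, Nat.cast_sub Nat.one_le_two_pow]
      push_cast
      rw [ZMod.pow_card_sub_one_eq_one (two_ne_zero_of_odd hh), sub_self]
    obtain ⟨t, ht⟩ := h1
    have := Nat.one_le_two_pow (n := p - 1)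
    exact ⟨t, by omega⟩
  have hq : ((2 : ℚ) ^ (p - 1) - 1) / (p : ℚ) = t := by
    have h1 : (2 : ℚ) ^ (p - 1) = 1 + p * t := by exact_mod_cast ht
    rw [h1]; field_simp; ring
  have hreindex : ∑ k ∈ Icc ((p ^ (s + 1) + 3) / 2) (p ^ (s + 1) - 1), G (p ^ (s + 1)) k =
      ∑ j ∈ range (M - 1), G (p ^ (s + 1)) (2 * M - j) := by
    refine sum_nbij' (fun k => 2 * M - k) (fun j => 2 * M - j) ?_ ?_ ?_ ?_ ?_
    · intro k hk; rw [mem_Icc] at hk; rw [mem_range]; omega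
    · intro j hj; rw [mem_range] at hj; rw [mem_Icc]; omega
    · intro k hk; rw [mem_Icc] at hk; omega
    · intro j hj; rw [mem_range] at hj; omega
    · intro k hk; rw [mem_Icc] at hk; congr 1; omega
  choose! U hGU hU using fun (j : ℕ) (hj : j + 1 < M) => G_reducesTo (p := p) (r := s) hh hM hj
  have hlt : ∀ j ∈ range (M - 1), j + 1 < M := fun j hj => by rw [mem_range] at hj; omega
  have hW : ReducesTo p (∑ j ∈ range (M - 1), (p : ℚ) ^ s / ((2 * (j + 1) + 1 : ℕ) : ℚ) * U j)
      (∑ j ∈ range (M - 1), if p ^ s ∣ 2 * (j + 1) + 1 then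
        (((2 * (j + 1) + 1) / p ^ s : ℕ) : ZMod p)⁻¹ * -(15 * scaledCentral p (j + 1)) else 0) := by
    refine ReducesTo.sum fun j hj => ?_
    have hjM := hlt j hj
    split_ifs with hd
    · refine ReducesTo.mul ?_ (hU j hjM)
      obtain ⟨u, hu⟩ := hd
      have hpu : ¬ p ∣ u := by
        rintro ⟨w, rfl⟩
        have h1 : p ^ (s + 1) ∣ 2 * (j + 1) + 1 := ⟨w, by rw [hu]; ring⟩
        exact Nat.not_dvd_of_pos_of_lt (by omega) (by omega) h1
      have := ReducesTo.pow_div_pow_mul (p := p) (le_refl s) hpu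
      rw [hu, Nat.mul_div_cancel_left _ (pow_pos hp.pos s)]
      simpa using this
    · simpa using (ReducesTo.pow_div_of_not_dvd (by omega) hd).mul (hU j hjM)
  rw [← sum_filter, sum_scaledCentral_filter hh (by omega) hp3 hM, ← mul_sum,
    sum_scaledCentral_div hh t ht] at hW
  have hT : ReducesTo p ((-1) ^ (h * (s + 1)) * 15 * (t : ℚ)) ((-1) ^ (h * (s + 1)) * 15 * t) := by
    exact_mod_cast ((ReducesTo.one (p := p)).neg.pow (h * (s + 1))).mul
      (ReducesTo.natCast 15) |>.mul (ReducesTo.natCast t)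
  have hdiff := hW.sub hT
  rw [show -(15 * (-1 : ZMod p) ^ (h * s)) * -((-1) ^ h * t) - (-1) ^ (h * (s + 1)) * 15 * t = 0 by
    ring] at hdiff
  rw [hreindex, hq, show (p ^ (s + 1) - 1) / 2 = M by omega,
    neg_one_pow_half_pow hh _ _ hM, sum_congr rfl fun j hj => hGU j (hlt j hj), ← mul_sum]
  have hfactor : (p : ℚ) ^ (s + 2) *
      (∑ j ∈ range (M - 1), (p : ℚ) ^ s / ((2 * (j + 1) + 1 : ℕ) : ℚ) * U j) -
        (-1) ^ (h * (s + 1)) * 15 * (p : ℚ) ^ (s + 1 + 1) * t =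
      (p : ℚ) ^ (s + 2) * ((∑ j ∈ range (M - 1),
        (p : ℚ) ^ s / ((2 * (j + 1) + 1 : ℕ) : ℚ) * U j) - (-1) ^ (h * (s + 1)) * 15 * (t : ℚ)) := by
    ring
  unfold pcong
  rw [hfactor, ← sub_eq_zero, hfactor, mul_eq_zero, or_iff_not_imp_left]
  intro hne
  exact hdiff.padicValRat_pow_mul (fun h0 => hne (Or.inr h0)) (s + 2)
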